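/- For a = 1,…,k let (Vₐ, Ωₐ, λₐ) be cosymplectic vector spaces: Vₐ a finite-dimensional real vector space, Ωₐ an alternating bilinear form with dim ker Ωₐ = 1, and λₐ a linear functional with ker Ωₐ ∩ ker λₐ = {0} and λₐ ≠ 0. On V = V₁ × ⋯ × V_k define ωᵃ(v,w) = Ωₐ(vₐ,wₐ) and ηᵃ(v) = λₐ(vₐ) for v = (v₁,…,v_k), w = (w₁,…,w_k). Then (V, ω¹,…,ωᵏ, η¹,…,ηᵏ) is a k-polycosymplectic vector space: η¹,…,ηᵏ are linearly independent, (⋂ₐ ker ωᵃ) ∩ (⋂ₐ ker ηᵃ) = {0}, and dim(⋂ₐ ker ωᵃ) = k. -/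

import Mathlib

variable {V : Type*} [AddCommGroup V] [Module ℝ V]

/-- The orthogonal of a subspace `S` with respect to a bilinear form `Ω`:
`S^Ω = {v ∈ V : Ω(v,s) = 0 for all s ∈ S}`. -/
def biOrtho (Ω : V →ₗ[ℝ] V →ₗ[ℝ] ℝ) (S : Submodule ℝ V) : Submodule ℝ V where
  carrier := {v | ∀ s ∈ S, Ω v s = 0}
  add_mem' := by
    intro a b ha hb s hs
    simp [map_add, LinearMap.add_apply, ha s hs, hb s hs]
  zero_mem' := by intro s hs; simp
  smul_mem' := by
    intro c a ha s hs
    simp [map_smul, LinearMap.smul_apply, ha s hs]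

/-- The kernel of a bilinear form `Ω`: `ker Ω = {v ∈ V : Ω(v,w) = 0 for all w ∈ V}`. -/
def kerB (Ω : V →ₗ[ℝ] V →ₗ[ℝ] ℝ) : Submodule ℝ V := biOrtho Ω ⊤

/-- The polycosymplectic orthogonal of `S` with respect to a family of bilinear
forms: `S^cω = {v ∈ V : ωᵃ(v,s) = 0 for all s ∈ S and all a}`. -/
def cOrtho {k : ℕ} (ω : Fin k → V →ₗ[ℝ] V →ₗ[ℝ] ℝ) (S : Submodule ℝ V) : Submodule ℝ V :=
  ⨅ a, biOrtho (ω a) S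

@[simp]
theorem mem_kerB {Ω : V →ₗ[ℝ] V →ₗ[ℝ] ℝ} {v : V} : v ∈ kerB Ω ↔ ∀ w, Ω v w = 0 :=
  ⟨fun h w => h w trivial, fun h w _ => h w⟩

/-- A product of submodules, as a submodule of the product, is linearly equivalent to the product
of the underlying modules. -/
def Submodule.piUnivEquiv {R ι : Type*} [Semiring R] {M : ι → Type*} [∀ i, AddCommMonoid (M i)]
    [∀ i, Module R (M i)] (p : ∀ i, Submodule R (M i)) :
    Submodule.pi Set.univ p ≃ₗ[R] ∀ i, p i where
  toFun x i := ⟨x.1 i, x.2 i trivial⟩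
  invFun y := ⟨fun i => y i, fun i _ => (y i).2⟩
  map_add' _ _ := rfl
  map_smul' _ _ := rfl

/-- The common kernel of bilinear forms pulled back from the factors of a product is the product
of their kernels. -/
theorem iInf_kerB_eq_pi {ι : Type*} {W : ι → Type*} [∀ a, AddCommGroup (W a)]
    [∀ a, Module ℝ (W a)] {Ω : ∀ a, W a →ₗ[ℝ] W a →ₗ[ℝ] ℝ}
    {ω : ι → (∀ a, W a) →ₗ[ℝ] (∀ a, W a) →ₗ[ℝ] ℝ}
    (hω : ∀ a (v w : ∀ b, W b), ω a v w = Ω a (v a) (w a)) :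
    ⨅ a, kerB (ω a) = Submodule.pi Set.univ fun a => kerB (Ω a) := by
  classical
  ext v
  simp only [Submodule.mem_iInf, Submodule.mem_pi, Set.mem_univ, true_implies, mem_kerB, hω]
  refine forall_congr' fun a => ⟨fun h w => ?_, fun h w => h (w a)⟩
  simpa using h (Pi.single a w)

/-- Nonzero functionals pulled back from the distinct factors of a product are linearly
independent. -/
theorem linearIndependent_of_apply_eq_apply_proj {K ι : Type*} [Field K] {W : ι → Type*}
    [∀ a, AddCommGroup (W a)] [∀ a, Module K (W a)] {l : ∀ a, W a →ₗ[K] K} (hl : ∀ a, l a ≠ 0)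
    {η : ι → (∀ a, W a) →ₗ[K] K} (hη : ∀ a (v : ∀ b, W b), η a v = l a (v a)) :
    LinearIndependent K η := by
  classical
  rw [linearIndependent_iff']
  intro s g hg a ha
  obtain ⟨x, hx⟩ := DFunLike.ne_iff.mp (hl a)
  have h := LinearMap.congr_fun hg (Pi.single a x)
  rw [LinearMap.sum_apply, Finset.sum_eq_single_of_mem a ha] at h
  · simpa [hη, show l a x ≠ 0 from hx] using h
  · intro b _ hb
    simp [hη, Pi.single_eq_of_ne hb]

/-- The product of cosymplectic vector spaces (Wₐ, Ωₐ, λₐ), with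
ωᵃ(v,w) = Ωₐ(vₐ,wₐ) and ηᵃ(v) = λₐ(vₐ), is a k-polycosymplectic vector space. -/
theorem product_of_cosymplectic_is_polycosymplectic
    {k : ℕ}
    (W : Fin k → Type*) [∀ a, AddCommGroup (W a)] [∀ a, Module ℝ (W a)]
    [∀ a, FiniteDimensional ℝ (W a)]
    (Ω : ∀ a, W a →ₗ[ℝ] W a →ₗ[ℝ] ℝ) (hΩalt : ∀ a v, Ω a v v = 0)
    (hΩker : ∀ a, Module.finrank ℝ ↥(kerB (Ω a)) = 1)
    (lam : ∀ a, W a →ₗ[ℝ] ℝ)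
    (hlam : ∀ a, kerB (Ω a) ⊓ LinearMap.ker (lam a) = ⊥)
    (hlamne : ∀ a, lam a ≠ 0)
    (ω : Fin k → (∀ a, W a) →ₗ[ℝ] (∀ a, W a) →ₗ[ℝ] ℝ)
    (hω : ∀ a (v w : ∀ b, W b), ω a v w = Ω a (v a) (w a))
    (η : Fin k → (∀ a, W a) →ₗ[ℝ] ℝ)
    (hη : ∀ a (v : ∀ b, W b), η a v = lam a (v a)) :
    LinearIndependent ℝ η ∧
    (⨅ a, kerB (ω a)) ⊓ (⨅ a, LinearMap.ker (η a)) = ⊥ ∧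
    Module.finrank ℝ ↥(⨅ a, kerB (ω a)) = k := by
  refine ⟨linearIndependent_of_apply_eq_apply_proj hlamne hη, ?_, ?_⟩
  · rw [iInf_kerB_eq_pi hω, eq_bot_iff]
    rintro v ⟨hv, hv'⟩
    refine (Submodule.mem_bot ℝ).2 (funext fun a => ?_)
    have hva : lam a (v a) = 0 := by
      rw [← hη]
      exact (Submodule.mem_iInf _).1 hv' a
    exact (Submodule.mem_bot ℝ).1 (hlam a ▸ ⟨hv a trivial, hva⟩)
  · rw [iInf_kerB_eq_pi hω, (Submodule.piUnivEquiv _).finrank_eq, Module.finrank_pi_fintype]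
    simp [hΩker]
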